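/- arXiv:1403.3513 — 5 statements merged into one kernel-verified Lean document; each statement's English description precedes it below -/
import Mathlib

section
/- The sequence F* defined from the scalar matrices of the minimal multigraded free resolution of S/I is a complex of T-modules (i.e. ∂*∘∂* = 0), and its zeroth homology is H_0(F*) = T/L, where L = Σ_{j=1}^m L_j. -/
open MvPolynomial

structure ResData (K : Type) [Field K] (σ : Type) [Fintype σ] [DecidableEq σ] where
  p : ℕ
  β : ℕ → ℕ
  hβ0 : β 0 = 1
  htop : ∀ i, p ≤ i → β (i + 1) = 0
  a : ∀ i, Fin (β i) → σ → ℕ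
  ha0 : ∀ j l, a 0 j l = 0
  lam : ∀ i, Matrix (Fin (β i)) (Fin (β (i + 1))) K
  hmin : ∀ i k j, lam i k j ≠ 0 →
    (∀ l, a i k l ≤ a (i + 1) j l) ∧ a i k ≠ a (i + 1) j

namespace ResData

variable {K : Type} [Field K] {σ : Type} [Fintype σ] [DecidableEq σ]

noncomputable def smat (R : ResData K σ) (i : ℕ) :
    Matrix (Fin (R.β i)) (Fin (R.β (i + 1))) (MvPolynomial σ K) := fun k j =>
  R.lam i k j • monomial (Finsupp.equivFunOnFinite.symm fun l => R.a (i + 1) j l - R.a i k l) 1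

def IsMinFreeResOf (R : ResData K σ) (I : Ideal (MvPolynomial σ K)) : Prop :=
  (∀ i, LinearMap.range (Matrix.mulVecLin (R.smat (i + 1))) =
      LinearMap.ker (Matrix.mulVecLin (R.smat i))) ∧
  ∀ j₀ : Fin (R.β 0),
    Submodule.map (LinearMap.proj j₀) (LinearMap.range (Matrix.mulVecLin (R.smat 0))) = I

/-- Castelnuovo–Mumford regularity of the ideal `I` resolved by `R`,
`reg I = max { |a_{i+1,j}| - i }`, read off from the shifts of the minimal
free resolution of `S/I`. -/
def regIdeal (R : ResData K σ) : ℕ :=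
  (Finset.range R.p).sup fun i =>
    Finset.univ.sup fun j : Fin (R.β (i + 1)) => (∑ l, R.a (i + 1) j l) - i

/-- projective dimension of the module `S/I` resolved by `R`. -/
def pd (R : ResData K σ) : ℕ :=
  ((Finset.range (R.p + 1)).filter fun i => R.β i ≠ 0).sup id

end ResData

/-- `J` is an ideal generated by monomials whose support lies in `s`. -/
def IsMonomialIdealOn {K : Type} [Field K] {σ : Type} (s : Set σ)
    (J : Ideal (MvPolynomial σ K)) : Prop :=
  ∃ A : Set (σ →₀ ℕ), (∀ b ∈ A, (b.support : Set σ) ⊆ s) ∧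
    J = Ideal.span ((fun b => (monomial b (1 : K) : MvPolynomial σ K)) '' A)

/-- An ideal generated by monomials. -/
def IsMonomialIdeal {K : Type} [Field K] {σ : Type} (J : Ideal (MvPolynomial σ K)) : Prop :=
  IsMonomialIdealOn Set.univ J

/-- The ideal `J` has a `d`-linear resolution: in the minimal multigraded free
resolution of `S/J` all shifts in homological degree `i ≥ 1` have total degree
`(i - 1) + d`. -/
def HasLinearRes {K : Type} [Field K] {σ : Type} [Fintype σ] [DecidableEq σ]
    (d : ℕ) (J : Ideal (MvPolynomial σ K)) : Prop :=
  ∃ R : ResData K σ, R.IsMinFreeResOf J ∧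
    ∀ i, 1 ≤ i → ∀ j : Fin (R.β i), (∑ l, R.a i j l) = (i - 1) + d

section Lstar

variable {K : Type} [Field K] {σ : Type} [Fintype σ] [DecidableEq σ]
variable {τ : Type} [Fintype τ] [DecidableEq τ]

/-- The ideals `L_{ij}` of the complex `F*` induced by the resolution data `R`
and the ideals `L_j = Lvec j`:  `Lstar R Lvec 0 j = L_{1j} = L_j` and
`L_{i+1, j} = ⋂ { L_{i,k} : λ^{(i+1)}_{kj} ≠ 0 }` (paper numbering shifted by one). -/
noncomputable def Lstar (R : ResData K σ) (Lvec : Fin (R.β 1) → Ideal (MvPolynomial τ K)) :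
    (i : ℕ) → Fin (R.β (i + 1)) → Ideal (MvPolynomial τ K)
  | 0, j => Lvec j
  | (i + 1), j => ⨅ (k : Fin (R.β (i + 1))) (_ : R.lam (i + 1) k j ≠ 0), Lstar R Lvec i k

/-- The module `F*_i`, realized as a submodule of the free module `T^{β_i}`. -/
noncomputable def FstarSub (R : ResData K σ) (Lvec : Fin (R.β 1) → Ideal (MvPolynomial τ K)) :
    (i : ℕ) → Submodule (MvPolynomial τ K) (Fin (R.β i) → MvPolynomial τ K)
  | 0 => ⊤
  | (i + 1) => Submodule.pi Set.univ fun j => Lstar R Lvec i j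

end Lstar

namespace ResData

variable {K : Type} [Field K] {σ : Type} [Fintype σ] [DecidableEq σ]

theorem IsMinFreeResOf.smat_mulVec_smat_mulVec {R : ResData K σ} {I : Ideal (MvPolynomial σ K)}
    (hI : R.IsMinFreeResOf I) (i : ℕ) (v : Fin (R.β (i + 2)) → MvPolynomial σ K) :
    (R.smat i).mulVec ((R.smat (i + 1)).mulVec v) = 0 := by
  have h : (R.smat (i + 1)).mulVec v ∈ LinearMap.range (Matrix.mulVecLin (R.smat (i + 1))) :=
    ⟨v, rfl⟩
  rw [hI.1 i] at h
  exact h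

theorem map_eval_one_smat (R : ResData K σ) (i : ℕ) :
    (R.smat i).map (eval fun _ => (1 : K)) = R.lam i := by
  ext k j
  simp [smat, eval_monomial, smul_eval]

theorem constantCoeff_smat (R : ResData K σ) (i : ℕ) (k : Fin (R.β i))
    (j : Fin (R.β (i + 1))) : constantCoeff (R.smat i k j) = 0 := by
  by_cases h : R.lam i k j = 0
  · simp [smat, h]
  · obtain ⟨hle, hne⟩ := R.hmin i k j h
    have hd : (Finsupp.equivFunOnFinite.symm fun l => R.a (i + 1) j l - R.a i k l) ≠ 0 := by
      intro h0
      refine hne (funext fun l => le_antisymm (hle l) ?_)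
      have := DFunLike.congr_fun h0 l
      simpa [Nat.sub_eq_zero_iff_le] using this
    simp [smat, constantCoeff_eq, coeff_monomial, hd]

/-- The scalar matrices of a minimal free resolution form a complex. -/
theorem IsMinFreeResOf.lam_mul_lam {R : ResData K σ} {I : Ideal (MvPolynomial σ K)}
    (hI : R.IsMinFreeResOf I) (i : ℕ) : R.lam i * R.lam (i + 1) = 0 := by
  have h : R.smat i * R.smat (i + 1) = 0 := by
    apply Matrix.ext_of_mulVec_single
    intro j
    rw [← Matrix.mulVec_mulVec, hI.smat_mulVec_smat_mulVec, Matrix.zero_mulVec]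
  rw [← R.map_eval_one_smat i, ← R.map_eval_one_smat (i + 1), ← Matrix.map_mul, h,
    Matrix.map_zero _ (map_zero _)]

/-- In a minimal free resolution no column of a scalar matrix vanishes. -/
theorem IsMinFreeResOf.exists_lam_ne_zero {R : ResData K σ} {I : Ideal (MvPolynomial σ K)}
    (hI : R.IsMinFreeResOf I) (i : ℕ) (j : Fin (R.β (i + 1))) : ∃ k, R.lam i k j ≠ 0 := by
  by_contra! h
  have hker : (Pi.single j 1 : Fin (R.β (i + 1)) → MvPolynomial σ K) ∈
      LinearMap.ker (Matrix.mulVecLin (R.smat i)) := by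
    ext1 k
    simp [smat, h]
  rw [← hI.1 i] at hker
  obtain ⟨v, hv⟩ := hker
  have := congrArg constantCoeff (congrFun hv j)
  simp [Matrix.mulVec, dotProduct, constantCoeff_smat] at this

end ResData

/-- **Lemma (easyforroya).** `F*` is a complex of `T`-modules with `H₀(F*) = T/L`:
the scalar matrices map `F*_{i+1}` into `F*_i`, the composition of two consecutive
differentials of `F*` vanishes, and the image of `∂* : F*_1 → F*_0 = T` is exactly
`L = ∑ j, L_j` (so that the zeroth homology of `F*` is `T/L`). -/
theorem Fstar_isComplex_and_H0_eq_quotient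
    {K : Type} [Field K] {n : ℕ}
    (R : ResData K (Fin n)) (I : Ideal (MvPolynomial (Fin n) K))
    (hI : R.IsMinFreeResOf I) (hInotTop : I ≠ ⊤)
    {τ : Type} [Fintype τ] [DecidableEq τ]
    (Lvec : Fin (R.β 1) → Ideal (MvPolynomial τ K))
    (hLmon : ∀ j, IsMonomialIdeal (Lvec j)) :
    (∀ (i : ℕ) (u : Fin (R.β (i + 2)) → MvPolynomial τ K),
        (∀ j, u j ∈ Lstar R Lvec (i + 1) j) →
        ∀ k, Matrix.mulVec ((R.lam (i + 1)).map (algebraMap K (MvPolynomial τ K))) u k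
          ∈ Lstar R Lvec i k) ∧
    (∀ (i : ℕ) (u : Fin (R.β (i + 2)) → MvPolynomial τ K),
        (∀ j, u j ∈ Lstar R Lvec (i + 1) j) →
        Matrix.mulVec ((R.lam i).map (algebraMap K (MvPolynomial τ K)))
          (Matrix.mulVec ((R.lam (i + 1)).map (algebraMap K (MvPolynomial τ K))) u) = 0) ∧
    (∀ t : MvPolynomial τ K,
        (∃ u : Fin (R.β 1) → MvPolynomial τ K, (∀ j, u j ∈ Lvec j) ∧
          ∀ k, Matrix.mulVec ((R.lam 0).map (algebraMap K (MvPolynomial τ K))) u k = t) ↔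
        t ∈ ∑ j, Lvec j) := by
  refine ⟨fun i u hu k => ?_, fun i u _ => ?_, fun t => ?_⟩
  · rw [Matrix.mulVec, dotProduct]
    refine sum_mem fun j _ => ?_
    by_cases h : R.lam (i + 1) k j = 0
    · simp [h]
    · have hj := hu j
      simp only [Lstar, Submodule.mem_iInf] at hj
      exact Ideal.mul_mem_left _ _ (hj k h)
  · rw [Matrix.mulVec_mulVec, ← Matrix.map_mul, hI.lam_mul_lam,
      Matrix.map_zero _ (map_zero _), Matrix.zero_mulVec]
  · let k₀ : Fin (R.β 0) := ⟨0, by simp [R.hβ0]⟩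
    have hsub : ∀ k, k = k₀ := fun k => Fin.ext (by have := k.2; have := R.hβ0; simp [k₀]; omega)
    have hne : ∀ j, R.lam 0 k₀ j ≠ 0 := fun j => by
      obtain ⟨k, hk⟩ := hI.exists_lam_ne_zero 0 j
      rwa [hsub k] at hk
    rw [Ideal.sum_eq_sup, Finset.sup_eq_iSup, Submodule.mem_iSup_finset_iff_exists_sum]
    constructor
    · rintro ⟨u, hu, ht⟩
      exact ⟨fun j => ⟨algebraMap K _ (R.lam 0 k₀ j) * u j,
        Ideal.mul_mem_left _ _ (hu j)⟩, ht k₀⟩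
    · rintro ⟨f, rfl⟩
      refine ⟨fun j => algebraMap K _ (R.lam 0 k₀ j)⁻¹ * f j,
        fun j => Ideal.mul_mem_left _ _ (f j).2, fun k => ?_⟩
      rw [hsub k, Matrix.mulVec, dotProduct]
      refine Finset.sum_congr rfl fun j _ => ?_
      rw [Matrix.map_apply, ← mul_assoc, ← map_mul, mul_inv_cancel₀ (hne j), map_one, one_mul]
end

section
/- For the choice L_j = ∏_{i=1}^n L_{i,a_j(i)}, the ideals L_{ij} appearing in the induced complex F* are given by L_{ij} = ∏_{l=1}^n L_{l,a_{ij}(l)} for all 1 ≤ i ≤ p and 1 ≤ j ≤ β_i. -/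
open MvPolynomial

namespace ResData

variable {K : Type} [Field K] {σ : Type} [Fintype σ] [DecidableEq σ]

theorem constantCoeff_of_mem_ker {R : ResData K σ} {I : Ideal (MvPolynomial σ K)}
    (hI : R.IsMinFreeResOf I) (i : ℕ) {v : Fin (R.β (i + 1)) → MvPolynomial σ K}
    (hv : (R.smat i).mulVec v = 0) (j : Fin (R.β (i + 1))) : constantCoeff (v j) = 0 := by
  have hmem : v ∈ LinearMap.ker (Matrix.mulVecLin (R.smat i)) := by
    simpa [LinearMap.mem_ker] using hv
  rw [← hI.1 i] at hmem
  obtain ⟨w, rfl⟩ := hmem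
  simp [Matrix.mulVec, dotProduct, constantCoeff_smat]

/-- Each multidegree in homological degree at least two is the least common multiple of the
multidegrees occurring in the corresponding column of the differential. -/
theorem exists_lam_ne_zero_and_eq {R : ResData K σ} {I : Ideal (MvPolynomial σ K)}
    (hI : R.IsMinFreeResOf I) (i : ℕ) (j : Fin (R.β (i + 2))) (l : σ) :
    ∃ k, R.lam (i + 1) k j ≠ 0 ∧ R.a (i + 1) k l = R.a (i + 2) j l := by
  by_contra! h
  have hdvd : ∀ k, ∃ c, R.smat (i + 1) k j = X l * c := by
    intro k
    by_cases hk : R.lam (i + 1) k j = 0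
    · exact ⟨0, by simp [smat, hk]⟩
    · have hlt := lt_of_le_of_ne ((R.hmin _ k j hk).1 l) (h k hk)
      refine Dvd.dvd.trans ?_ (Dvd.intro_left (C (R.lam (i + 1) k j)) (smul_eq_C_mul _ _).symm)
      rw [X_dvd_monomial]
      right
      simp only [Finsupp.equivFunOnFinite_symm_apply_apply]
      omega
  choose c hc using hdvd
  have hcol : (R.smat (i + 1)).mulVec (Pi.single j 1) = (X l : MvPolynomial σ K) • c := by
    ext1 k
    simp [hc]
  have hcomp : (R.smat i).mulVec ((R.smat (i + 1)).mulVec (Pi.single j 1)) = 0 := by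
    have hmem : (R.smat (i + 1)).mulVec (Pi.single j 1) ∈
        LinearMap.ker (Matrix.mulVecLin (R.smat i)) := by
      rw [← hI.1 i]
      exact ⟨_, rfl⟩
    simpa [LinearMap.mem_ker] using hmem
  have hc_ker : c ∈ LinearMap.ker (Matrix.mulVecLin (R.smat i)) := by
    rw [hcol, Matrix.mulVec_smul] at hcomp
    rw [LinearMap.mem_ker, Matrix.mulVecLin_apply]
    exact (smul_eq_zero.mp hcomp).resolve_left (X_ne_zero l)
  rw [← hI.1 i] at hc_ker
  obtain ⟨d, rfl⟩ := hc_ker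
  have hker : (R.smat (i + 1)).mulVec (Pi.single j 1 - (X l : MvPolynomial σ K) • d) = 0 := by
    rw [Matrix.mulVec_sub, hcol, Matrix.mulVec_smul, Matrix.mulVecLin_apply, sub_self]
  simpa using constantCoeff_of_mem_ker hI (i + 1) hker j

theorem exists_generator_degree_eq {R : ResData K σ} {I : Ideal (MvPolynomial σ K)}
    (hI : R.IsMinFreeResOf I) (l : σ) (i : ℕ) (j : Fin (R.β (i + 1))) :
    ∃ j₁ : Fin (R.β 1), R.a 1 j₁ l = R.a (i + 1) j l := by
  induction i with
  | zero => exact ⟨j, rfl⟩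
  | succ i ih =>
    obtain ⟨k, -, hk⟩ := exists_lam_ne_zero_and_eq hI i j l
    obtain ⟨j₁, hj₁⟩ := ih k
    exact ⟨j₁, hj₁.trans hk⟩

end ResData

/-- Monomial ideals in pairwise disjoint sets of variables have product equal to their
intersection. -/
theorem prod_eq_iInf_of_isMonomialIdealOn {K : Type} [Field K] {τ ι : Type} [Fintype ι]
    (π : τ → ι) (J : ι → Ideal (MvPolynomial τ K))
    (hJ : ∀ l, IsMonomialIdealOn {v | π v = l} (J l)) : ∏ l, J l = ⨅ l, J l := by
  refine le_antisymm (le_iInf fun l => Ideal.prod_le_inf.trans (Finset.inf_le (Finset.mem_univ l)))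
    fun f hf => ?_
  choose A hA hspan using hJ
  rw [f.as_sum]
  refine Ideal.sum_mem _ fun e he => ?_
  have hdiv : ∀ l, ∃ s ∈ A l, s ≤ e := by
    intro l
    have hl : f ∈ J l := (Submodule.mem_iInf _).mp hf l
    rw [hspan l, mem_ideal_span_monomial_image] at hl
    exact hl e he
  choose s hsA hse using hdiv
  have hsum : ∑ l, s l ≤ e := by
    intro v
    rw [Finsupp.finsetSum_apply, Finset.sum_eq_single (π v)]
    · exact hse (π v) v
    · intro l _ hl
      by_contra hv
      exact hl (hA l _ (hsA l) (Finset.mem_coe.mpr (Finsupp.mem_support_iff.mpr hv))).symm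
    · simp
  have hprod : ∏ l, monomial (s l) (1 : K) ∈ ∏ l, J l :=
    Ideal.prod_mem_prod fun l _ => by
      rw [hspan l]
      exact Ideal.subset_span ⟨s l, hsA l, rfl⟩
  rw [← monomial_sum_one] at hprod
  have hmul := Ideal.mul_mem_left _ (monomial (e - ∑ l, s l) (coeff e f)) hprod
  rwa [monomial_mul, mul_one, tsub_add_cancel_of_le hsum] at hmul

/-- **Corollary (lij).** For the choice `L_j = ∏_{l=1}^n L_{l, a_j(l)}`, the ideals
`L_{ij}` of the induced complex `F*` satisfy `L_{ij} = ∏_{l=1}^n L_{l, a_{ij}(l)}`.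
(The paper's level `i` ideal `L_{ij}` is `Lstar R Lvec (i - 1) j` below.) -/
theorem Lstar_eq_prod_Lfam
    {K : Type} [Field K] {n : ℕ} (mfam : Fin n → ℕ)
    (R : ResData K (Fin n)) (I : Ideal (MvPolynomial (Fin n) K))
    (hI : R.IsMinFreeResOf I) (hInotTop : I ≠ ⊤)
    (Lfam : Fin n → ℕ → Ideal (MvPolynomial ((i : Fin n) × Fin (mfam i)) K))
    (hmon : ∀ (l : Fin n) (j : Fin (R.β 1)),
      IsMonomialIdealOn {v : (i : Fin n) × Fin (mfam i) | v.1 = l} (Lfam l (R.a 1 j l)))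
    (hincl : ∀ (l : Fin n) (j k : Fin (R.β 1)),
      R.a 1 k l ≤ R.a 1 j l → Lfam l (R.a 1 j l) ≤ Lfam l (R.a 1 k l)) :
    ∀ (i : ℕ) (j : Fin (R.β (i + 1))),
      Lstar R (fun j' => ∏ l, Lfam l (R.a 1 j' l)) i j = ∏ l, Lfam l (R.a (i + 1) j l) := by
  intro i
  induction i with
  | zero => exact fun j => rfl
  | succ i ih =>
    intro j
    simp only [Lstar, ih]
    refine le_antisymm ?_ (le_iInf₂ fun k hk => ?_)
    · rw [prod_eq_iInf_of_isMonomialIdealOn Sigma.fst fun l => Lfam l (R.a (i + 2) j l)]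
      · refine le_iInf fun l => ?_
        obtain ⟨k, hk, hkl⟩ := ResData.exists_lam_ne_zero_and_eq hI i j l
        rw [← hkl]
        exact (iInf₂_le k hk).trans
          (Ideal.prod_le_inf.trans (Finset.inf_le (Finset.mem_univ l)))
      · intro l
        obtain ⟨j₁, hj₁⟩ := ResData.exists_generator_degree_eq hI l (i + 1) j
        rw [← hj₁]
        exact hmon l j₁
    · refine Finset.prod_le_prod' fun l _ => ?_
      have hle := (R.hmin (i + 1) k j hk).1 l
      obtain ⟨j₁, hj₁⟩ := ResData.exists_generator_degree_eq hI l (i + 1) j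
      obtain ⟨k₁, hk₁⟩ := ResData.exists_generator_degree_eq hI l i k
      rw [← hj₁, ← hk₁] at hle ⊢
      exact hincl l j₁ k₁ hle
end

section
/- Let F be the minimal ℤ^n-graded free S-resolution of S/I with scalar matrices λ^{(i)}, and let μ = (μ_1,…,μ_{β_i}) ∈ Ker λ^{(i)} ⊆ K^{β_i}. Let k_1 < ⋯ < k_r be the integers with μ_{k_t} ≠ 0. Then there exists ρ ∈ K^{β_{i+1}} such that λ^{(i+1)}ρ = μ and such that x^{a_{i+1,j}} divides lcm(x^{a_{i,k_1}},…,x^{a_{i,k_r}}) for every j with ρ_j ≠ 0. -/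
open MvPolynomial

namespace ResData

variable {K : Type} [Field K] {σ : Type} [Fintype σ] [DecidableEq σ]

/-- The degree-`b` homogeneous element of the free module in degree `i` with coefficients `μ`. -/
noncomputable def homogenize (R : ResData K σ) (i : ℕ) (b : σ → ℕ) (μ : Fin (R.β i) → K) :
    Fin (R.β i) → MvPolynomial σ K := fun k =>
  monomial (Finsupp.equivFunOnFinite.symm fun l => b l - R.a i k l) (μ k)

open Classical in
/-- The coefficient vector of the degree-`b` component of an element of the free module
in degree `i`. -/
noncomputable def degreePart (R : ResData K σ) (i : ℕ) (b : σ → ℕ)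
    (v : Fin (R.β i) → MvPolynomial σ K) : Fin (R.β i) → K := fun k =>
  if R.a i k ≤ b then
    coeff (Finsupp.equivFunOnFinite.symm fun l => b l - R.a i k l) (v k)
  else 0

theorem degreePart_homogenize (R : ResData K σ) (i : ℕ) (b : σ → ℕ) (μ : Fin (R.β i) → K)
    (hμ : ∀ k, μ k ≠ 0 → R.a i k ≤ b) : R.degreePart i b (R.homogenize i b μ) = μ := by
  funext k
  by_cases h : R.a i k ≤ b
  · simp [degreePart, homogenize, h]
  · have : μ k = 0 := by_contra fun h0 => h (hμ k h0)
    simp [degreePart, h, this]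

theorem smat_mulVec_homogenize (R : ResData K σ) (i : ℕ) (b : σ → ℕ)
    (μ : Fin (R.β (i + 1)) → K) (hμ : ∀ k, μ k ≠ 0 → R.a (i + 1) k ≤ b) :
    (R.smat i).mulVec (R.homogenize (i + 1) b μ) = R.homogenize i b ((R.lam i).mulVec μ) := by
  funext m
  simp only [Matrix.mulVec, dotProduct, homogenize, map_sum]
  refine Finset.sum_congr rfl fun k _ => ?_
  by_cases hl : R.lam i m k = 0
  · simp [smat, hl]
  by_cases hk : μ k = 0
  · simp [hk]
  have h₁ := (R.hmin i m k hl).1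
  have h₂ := hμ k hk
  rw [smat, smul_mul_assoc, monomial_mul, smul_monomial, one_mul, smul_eq_mul]
  congr 2
  ext l
  have := h₁ l
  have : R.a (i + 1) k l ≤ b l := h₂ l
  simp only [Finsupp.add_apply, Finsupp.equivFunOnFinite_symm_apply_apply]
  omega

theorem degreePart_smat_mulVec (R : ResData K σ) (i : ℕ) (b : σ → ℕ)
    (v : Fin (R.β (i + 1)) → MvPolynomial σ K) :
    R.degreePart i b ((R.smat i).mulVec v) = (R.lam i).mulVec (R.degreePart (i + 1) b v) := by
  funext k
  simp only [Matrix.mulVec, dotProduct, degreePart]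
  split_ifs with hk
  · rw [coeff_sum]
    refine Finset.sum_congr rfl fun j _ => ?_
    by_cases hl : R.lam i k j = 0
    · simp [smat, hl]
    have h₁ := (R.hmin i k j hl).1
    rw [smat, smul_mul_assoc, coeff_smul, coeff_monomial_mul', one_mul, smul_eq_mul]
    have hiff : ((Finsupp.equivFunOnFinite.symm fun l => R.a (i + 1) j l - R.a i k l) ≤
        (Finsupp.equivFunOnFinite.symm fun l => b l - R.a i k l)) ↔ R.a (i + 1) j ≤ b := by
      rw [Finsupp.le_def, Pi.le_def]
      refine forall_congr' fun l => ?_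
      have := h₁ l
      have : R.a i k l ≤ b l := hk l
      simp only [Finsupp.equivFunOnFinite_symm_apply_apply]
      omega
    by_cases hj : R.a (i + 1) j ≤ b
    swap
    · rw [if_neg hj, if_neg (mt hiff.1 hj), mul_zero]
    rw [if_pos hj, if_pos (hiff.2 hj)]
    congr 2
    ext l
    have := h₁ l
    simp only [Finsupp.tsub_apply, Finsupp.equivFunOnFinite_symm_apply_apply]
    omega
  · refine (Finset.sum_eq_zero fun j _ => ?_).symm
    by_cases hl : R.lam i k j = 0
    · simp [hl]
    · rw [if_neg fun h => hk (le_trans (R.hmin i k j hl).1 h), mul_zero]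

end ResData

/-- **Lemma (needed).** Let `μ ∈ K^{β_i}` with `λ^{(i)} μ = 0` and let
`k_1 < ⋯ < k_r` be the indices with `μ_{k_t} ≠ 0`.  Then there exists
`ρ ∈ K^{β_{i+1}}` with `λ^{(i+1)} ρ = μ` such that `x^{a_{i+1,j}}` divides
`lcm (x^{a_{i,k_1}}, …, x^{a_{i,k_r}})` for every `j` with `ρ_j ≠ 0`; in terms of
exponent vectors, `a_{i+1,j}(l) ≤ max_t a_{i,k_t}(l)` for all `l`.
(The paper's level `i` is `i + 1` below, so `λ^{(i+1)}` is the matrix `R.lam i`.) -/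
theorem exists_preimage_with_divisibility
    {K : Type} [Field K] {n : ℕ}
    (R : ResData K (Fin n)) (I : Ideal (MvPolynomial (Fin n) K))
    (hI : R.IsMinFreeResOf I) (hInotTop : I ≠ ⊤) :
    ∀ (i : ℕ) (μ : Fin (R.β (i + 1)) → K),
      Matrix.mulVec (R.lam i) μ = 0 →
      ∃ ρ : Fin (R.β (i + 2)) → K,
        Matrix.mulVec (R.lam (i + 1)) ρ = μ ∧
        ∀ j : Fin (R.β (i + 2)), ρ j ≠ 0 → ∀ l : Fin n,
          R.a (i + 2) j l ≤ ⨆ k : {k : Fin (R.β (i + 1)) // μ k ≠ 0}, R.a (i + 1) k.1 l := by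
  intro i μ hμ
  set b : Fin n → ℕ := fun l => ⨆ k : {k : Fin (R.β (i + 1)) // μ k ≠ 0}, R.a (i + 1) k.1 l
    with hb
  have hle : ∀ k, μ k ≠ 0 → R.a (i + 1) k ≤ b := fun k hk l =>
    le_ciSup (f := fun k : {k : Fin (R.β (i + 1)) // μ k ≠ 0} => R.a (i + 1) k.1 l)
      (Set.finite_range _).bddAbove ⟨k, hk⟩
  have hker : R.homogenize (i + 1) b μ ∈ LinearMap.ker (Matrix.mulVecLin (R.smat i)) := by
    rw [LinearMap.mem_ker, Matrix.mulVecLin_apply, R.smat_mulVec_homogenize i b μ hle, hμ]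
    funext m
    simp [ResData.homogenize]
  rw [← hI.1 i] at hker
  obtain ⟨v, hv⟩ := hker
  rw [Matrix.mulVecLin_apply] at hv
  refine ⟨R.degreePart (i + 2) b v, ?_, fun j hj => ?_⟩
  · rw [← R.degreePart_smat_mulVec (i + 1) b v, hv, R.degreePart_homogenize _ b μ hle]
  · by_contra hnot
    exact hj (if_neg hnot)
end

section
/- Let L_j = ∏_{i=1}^n L_{i,a_j(i)} and let F* be the complex of L_1,…,L_m induced by I. Then F* is acyclic (H_i(F*) = 0 for all i > 0) and H_0(F*) = T/L, where L = Σ_{j=1}^m L_j. -/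
open MvPolynomial

namespace ResData

variable {K : Type} [Field K] {σ : Type} [Fintype σ] [DecidableEq σ]

/-- The strand of the resolution in degree `b` is exact in positive homological degrees. -/
theorem IsMinFreeResOf.exists_preimage_of_degree_le {R : ResData K σ}
    {I : Ideal (MvPolynomial σ K)} (hI : R.IsMinFreeResOf I) (b : σ → ℕ) (i : ℕ)
    (u : Fin (R.β (i + 1)) → K) (hu : ∀ j, u j ≠ 0 → R.a (i + 1) j ≤ b)
    (hker : (R.lam i).mulVec u = 0) :
    ∃ v : Fin (R.β (i + 2)) → K, (∀ j, v j ≠ 0 → R.a (i + 2) j ≤ b) ∧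
      (R.lam (i + 1)).mulVec v = u := by
  classical
  set d : (σ → ℕ) → (σ → ℕ) → (σ →₀ ℕ) := fun x y =>
    Finsupp.equivFunOnFinite.symm fun l => x l - y l with hd
  have hadd : ∀ x y z : σ → ℕ, x ≤ y → y ≤ z → d y x + d z y = d z x := by
    intro x y z hxy hyz
    ext l
    have h1 : x l ≤ y l := hxy l
    have h2 : y l ≤ z l := hyz l
    simp only [hd, Finsupp.coe_add, Pi.add_apply, Finsupp.equivFunOnFinite_symm_apply_apply]
    omega
  let U : Fin (R.β (i + 1)) → MvPolynomial σ K := fun j => monomial (d b (R.a (i + 1) j)) (u j)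
  have hU : U ∈ LinearMap.ker (Matrix.mulVecLin (R.smat i)) := by
    rw [LinearMap.mem_ker, Matrix.mulVecLin_apply]
    ext1 k
    have hk := congrFun hker k
    simp only [Matrix.mulVec, dotProduct, Pi.zero_apply] at hk ⊢
    have hterm : ∀ j, R.smat i k j * U j = monomial (d b (R.a i k)) (R.lam i k j * u j) := by
      intro j
      by_cases h1 : R.lam i k j = 0
      · simp [smat, h1]
      by_cases h2 : u j = 0
      · simp [U, h2]
      rw [← hadd _ _ _ (R.hmin i k j h1).1 (hu j h2)]
      simp [smat, U, smul_monomial, monomial_mul, hd]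
    rw [Finset.sum_congr rfl fun j _ => hterm j, ← map_sum, hk, map_zero]
  rw [← hI.1 i] at hU
  obtain ⟨V, hV⟩ := hU
  rw [Matrix.mulVecLin_apply] at hV
  refine ⟨fun j => if R.a (i + 2) j ≤ b then coeff (d b (R.a (i + 2) j)) (V j) else 0, ?_, ?_⟩
  · intro j hj
    by_contra h
    simp [h] at hj
  · ext1 k
    simp only [Matrix.mulVec, dotProduct]
    by_cases hk : R.a (i + 1) k ≤ b
    · have h := congrArg (coeff (d b (R.a (i + 1) k))) (congrFun hV k)
      simp only [U, coeff_monomial, if_true, Matrix.mulVec, dotProduct, coeff_sum] at h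
      rw [← h]
      refine Finset.sum_congr rfl fun j _ => ?_
      by_cases h1 : R.lam (i + 1) k j = 0
      · simp [smat, h1]
      have hkj : R.a (i + 1) k ≤ R.a (i + 2) j := (R.hmin (i + 1) k j h1).1
      have hs : R.smat (i + 1) k j =
          monomial (d (R.a (i + 2) j) (R.a (i + 1) k)) (R.lam (i + 1) k j) := by
        simp [smat, smul_monomial, hd]
      rw [hs]
      split_ifs with hb
      · rw [← hadd _ _ _ hkj hb, coeff_monomial_mul]
      · rw [coeff_monomial_mul', if_neg, mul_zero]
        intro hle
        apply hb
        intro l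
        change R.a (i + 2) j l ≤ b l
        have h1 := hle l
        have h2 : R.a (i + 1) k l ≤ R.a (i + 2) j l := hkj l
        have h3 : R.a (i + 1) k l ≤ b l := hk l
        simp only [hd, Finsupp.equivFunOnFinite_symm_apply_apply] at h1
        omega
    · have huk : u k = 0 := by
        by_contra h
        exact hk (hu k h)
      rw [huk]
      refine Finset.sum_eq_zero fun j _ => ?_
      by_cases h1 : R.lam (i + 1) k j = 0
      · simp [h1]
      have hkj : R.a (i + 1) k ≤ R.a (i + 2) j := (R.hmin (i + 1) k j h1).1
      rw [if_neg fun hb => hk (hkj.trans hb), mul_zero]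

/-- By minimality, a cycle of degree `a_{i+1,j}` does not involve the basis element `j`. -/
theorem IsMinFreeResOf.apply_eq_zero_of_mulVec_eq_zero {R : ResData K σ}
    {I : Ideal (MvPolynomial σ K)} (hI : R.IsMinFreeResOf I) (i : ℕ) (j : Fin (R.β (i + 1)))
    (u : Fin (R.β (i + 1)) → K) (hu : ∀ k, u k ≠ 0 → R.a (i + 1) k ≤ R.a (i + 1) j)
    (hker : (R.lam i).mulVec u = 0) : u j = 0 := by
  obtain ⟨v, hv, rfl⟩ := hI.exists_preimage_of_degree_le _ i u hu hker
  change ∑ k, R.lam (i + 1) j k * v k = 0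
  refine Finset.sum_eq_zero fun k _ => ?_
  by_contra h
  obtain ⟨hle, hne⟩ := R.hmin (i + 1) j k (left_ne_zero_of_mul h)
  exact hne (le_antisymm hle (hv k (right_ne_zero_of_mul h)))

/-- The shift `a_{i+2,j}` is the least common multiple of the shifts `a_{i+1,k}` with
`λ_{kj} ≠ 0`. -/
theorem IsMinFreeResOf.degree_le_iff {R : ResData K σ}
    {I : Ideal (MvPolynomial σ K)} (hI : R.IsMinFreeResOf I) (i : ℕ) (j : Fin (R.β (i + 2)))
    (c : σ → ℕ) :
    R.a (i + 2) j ≤ c ↔ ∀ k, R.lam (i + 1) k j ≠ 0 → R.a (i + 1) k ≤ c := by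
  refine ⟨fun h k hk => le_trans (R.hmin (i + 1) k j hk).1 h, fun h => ?_⟩
  by_contra hj
  obtain ⟨v, hv, hveq⟩ := hI.exists_preimage_of_degree_le (R.a (i + 2) j ⊓ c) i
    (fun k => R.lam (i + 1) k j)
    (fun k hk => le_inf (R.hmin (i + 1) k j hk).1 (h k hk))
    (by
      ext k
      exact congrFun (congrFun (hI.lam_mul_lam i) k) j)
  have hvj : v j = 0 := by
    by_contra hne
    exact hj ((hv j hne).trans inf_le_right)
  have := hI.apply_eq_zero_of_mulVec_eq_zero (i + 1) j (Pi.single j 1 - v)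
    (fun k hk => by
      by_cases hkj : k = j
      · rw [hkj]
      · have hvk : v k ≠ 0 := by simpa [hkj] using hk
        exact (hv k hvk).trans inf_le_left)
    (by
      rw [Matrix.mulVec_sub, hveq]
      ext k
      simp)
  simp [hvj] at this

end ResData

section MonomialIdeals

variable {K : Type} [Field K] {τ : Type}

theorem mem_of_forall_monomial_mem {J : Ideal (MvPolynomial τ K)} {f : MvPolynomial τ K}
    (h : ∀ w, coeff w f ≠ 0 → monomial w (1 : K) ∈ J) : f ∈ J := by
  rw [f.as_sum]
  refine J.sum_mem fun w hw => ?_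
  have := J.mul_mem_left (C (coeff w f)) (h w (mem_support_iff.mp hw))
  rwa [C_mul_monomial, mul_one] at this

theorem IsMonomialIdealOn.monomial_mem {s : Set τ} {J : Ideal (MvPolynomial τ K)}
    (hJ : IsMonomialIdealOn s J) {f : MvPolynomial τ K} (hf : f ∈ J) {w : τ →₀ ℕ}
    (hw : coeff w f ≠ 0) : monomial w (1 : K) ∈ J := by
  classical
  obtain ⟨A, -, rfl⟩ := hJ
  rw [mem_ideal_span_monomial_image] at hf ⊢
  intro x hx
  rw [support_monomial, if_neg one_ne_zero, Finset.mem_singleton] at hx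
  exact hx ▸ hf w (mem_support_iff.mpr hw)

theorem monomial_mem_prod_iff {n : ℕ} {m : Fin n → ℕ}
    {J : Fin n → Ideal (MvPolynomial ((i : Fin n) × Fin (m i)) K)}
    (hJ : ∀ l, IsMonomialIdealOn {v : (i : Fin n) × Fin (m i) | v.1 = l} (J l))
    (w : ((i : Fin n) × Fin (m i)) →₀ ℕ) :
    monomial w (1 : K) ∈ ∏ l, J l ↔ ∀ l, monomial w (1 : K) ∈ J l := by
  classical
  refine ⟨fun h l => ?_, fun h => ?_⟩
  · have := Ideal.prod_le_inf h
    exact (Finset.inf_le (f := J) (Finset.mem_univ l)) this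
  · have hb : ∀ l, ∃ b : ((i : Fin n) × Fin (m i)) →₀ ℕ,
        (b.support : Set _) ⊆ {v : (i : Fin n) × Fin (m i) | v.1 = l} ∧ b ≤ w ∧
          monomial b (1 : K) ∈ J l := by
      intro l
      obtain ⟨A, hA, hJA⟩ := hJ l
      have hl := h l
      rw [hJA, mem_ideal_span_monomial_image] at hl
      obtain ⟨b, hbA, hbw⟩ := hl w (by simp [support_monomial])
      exact ⟨b, hA b hbA, hbw, hJA ▸ Ideal.subset_span ⟨b, hbA, rfl⟩⟩
    choose b hsupp hle hmem using hb
    have hsum : ∑ l, b l ≤ w := by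
      intro v
      rw [Finsupp.finsetSum_apply, Finset.sum_eq_single v.1]
      · exact hle v.1 v
      · intro l _ hl
        by_contra hne
        exact hl (hsupp l (Finsupp.mem_support_iff.mpr hne)).symm
      · simp
    have hprod : monomial (∑ l, b l) (1 : K) ∈ ∏ l, J l := by
      have := Ideal.prod_mem_prod (s := Finset.univ) fun l _ => hmem l
      rwa [← monomial_sum_one] at this
    have := (∏ l, J l).mul_mem_left (monomial (w - ∑ l, b l) 1) hprod
    rwa [monomial_mul, tsub_add_cancel_of_le hsum, mul_one] at this

theorem monomial_mem_prod_of_mem_prod {n : ℕ} {m : Fin n → ℕ}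
    {J : Fin n → Ideal (MvPolynomial ((i : Fin n) × Fin (m i)) K)}
    (hJ : ∀ l, IsMonomialIdealOn {v : (i : Fin n) × Fin (m i) | v.1 = l} (J l))
    {f : MvPolynomial ((i : Fin n) × Fin (m i)) K} (hf : f ∈ ∏ l, J l)
    {w : ((i : Fin n) × Fin (m i)) →₀ ℕ} (hw : coeff w f ≠ 0) :
    monomial w (1 : K) ∈ ∏ l, J l := by
  rw [monomial_mem_prod_iff hJ]
  intro l
  exact (hJ l).monomial_mem
    ((Finset.inf_le (f := J) (Finset.mem_univ l)) (Ideal.prod_le_inf hf)) hw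

end MonomialIdeals

section Lstar

variable {K : Type} [Field K] {σ : Type} [Fintype σ] [DecidableEq σ] {τ : Type}

theorem monomial_mem_Lstar_of_mem {R : ResData K σ}
    {Lvec : Fin (R.β 1) → Ideal (MvPolynomial τ K)}
    (hL : ∀ j, ∀ f ∈ Lvec j, ∀ w, coeff w f ≠ 0 → monomial w (1 : K) ∈ Lvec j) (i : ℕ)
    (j : Fin (R.β (i + 1))) {f : MvPolynomial τ K} (hf : f ∈ Lstar R Lvec i j) {w : τ →₀ ℕ}
    (hw : coeff w f ≠ 0) : monomial w (1 : K) ∈ Lstar R Lvec i j := by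
  induction i with
  | zero => exact hL j f hf w hw
  | succ i ih =>
    simp only [Lstar, Submodule.mem_iInf] at hf ⊢
    exact fun k hk => ih k (hf k hk)

theorem mem_Lstar_iff_degree_le {R : ResData K σ} {I : Ideal (MvPolynomial σ K)}
    (hI : R.IsMinFreeResOf I) {Lvec : Fin (R.β 1) → Ideal (MvPolynomial τ K)}
    {f : MvPolynomial τ K} {b : σ → ℕ} (hb : ∀ j, f ∈ Lvec j ↔ R.a 1 j ≤ b) (i : ℕ)
    (j : Fin (R.β (i + 1))) : f ∈ Lstar R Lvec i j ↔ R.a (i + 1) j ≤ b := by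
  induction i with
  | zero => exact hb j
  | succ i ih =>
    simp only [Lstar, Submodule.mem_iInf, ih]
    exact (hI.degree_le_iff i j b).symm

theorem exists_mem_of_mem_Lstar {R : ResData K σ} {I : Ideal (MvPolynomial σ K)}
    (hI : R.IsMinFreeResOf I) {Lvec : Fin (R.β 1) → Ideal (MvPolynomial τ K)}
    {f : MvPolynomial τ K} (i : ℕ) (j : Fin (R.β (i + 1))) (hf : f ∈ Lstar R Lvec i j) :
    ∃ k, f ∈ Lvec k := by
  induction i with
  | zero => exact ⟨j, hf⟩
  | succ i ih =>
    simp only [Lstar, Submodule.mem_iInf] at hf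
    obtain ⟨k, hk⟩ := hI.exists_lam_ne_zero (i + 1) j
    exact ih k (hf k hk)

theorem coeff_map_algebraMap_mulVec {m n : Type} [Fintype n] (M : Matrix m n K)
    (u : n → MvPolynomial τ K) (w : τ →₀ ℕ) (k : m) :
    coeff w ((M.map (algebraMap K (MvPolynomial τ K))).mulVec u k) =
      M.mulVec (fun j => coeff w (u j)) k := by
  simp [Matrix.mulVec, dotProduct, coeff_sum, algebraMap_eq, coeff_C_mul]

/-- Exactness of the induced complex can be checked on the strands of each degree. -/
theorem exists_preimage_Lstar {R : ResData K σ} {I : Ideal (MvPolynomial σ K)}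
    (hI : R.IsMinFreeResOf I) {Lvec : Fin (R.β 1) → Ideal (MvPolynomial τ K)}
    (hL : ∀ j, ∀ f ∈ Lvec j, ∀ w, coeff w f ≠ 0 → monomial w (1 : K) ∈ Lvec j)
    (hdeg : ∀ w, (∃ j, monomial w (1 : K) ∈ Lvec j) →
      ∃ b : σ → ℕ, ∀ j, monomial w (1 : K) ∈ Lvec j ↔ R.a 1 j ≤ b)
    (i : ℕ) (u : Fin (R.β (i + 1)) → MvPolynomial τ K) (hu : ∀ j, u j ∈ Lstar R Lvec i j)
    (hker : ((R.lam i).map (algebraMap K (MvPolynomial τ K))).mulVec u = 0) :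
    ∃ v : Fin (R.β (i + 2)) → MvPolynomial τ K, (∀ j, v j ∈ Lstar R Lvec (i + 1) j) ∧
      ((R.lam (i + 1)).map (algebraMap K (MvPolynomial τ K))).mulVec v = u := by
  classical
  have hstrand : ∀ w : τ →₀ ℕ, ∃ v : Fin (R.β (i + 2)) → K,
      (∀ j, v j ≠ 0 → monomial w (1 : K) ∈ Lstar R Lvec (i + 1) j) ∧
        (R.lam (i + 1)).mulVec v = fun j => coeff w (u j) := by
    intro w
    by_cases hw : ∃ j, coeff w (u j) ≠ 0
    · obtain ⟨j₀, hj₀⟩ := hw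
      obtain ⟨b, hb⟩ := hdeg w
        (exists_mem_of_mem_Lstar hI i j₀ (monomial_mem_Lstar_of_mem hL i j₀ (hu j₀) hj₀))
      obtain ⟨v, hv, hvu⟩ := hI.exists_preimage_of_degree_le b i (fun j => coeff w (u j))
        (fun j hj => (mem_Lstar_iff_degree_le hI hb i j).mp
          (monomial_mem_Lstar_of_mem hL i j (hu j) hj))
        (by
          ext k
          rw [← coeff_map_algebraMap_mulVec, hker]
          simp)
      exact ⟨v, fun j hj => (mem_Lstar_iff_degree_le hI hb (i + 1) j).mpr (hv j hj), hvu⟩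
    · push Not at hw
      refine ⟨0, by simp, ?_⟩
      ext k
      simp [hw]
  choose v hv hvu using hstrand
  let s : Finset (τ →₀ ℕ) := Finset.univ.biUnion fun j => (u j).support
  have hcoeff : ∀ w j, coeff w (∑ x ∈ s, monomial x (v x j)) = if w ∈ s then v w j else 0 := by
    intro w j
    simp [coeff_sum, coeff_monomial]
  refine ⟨fun j => ∑ w ∈ s, monomial w (v w j), fun j => ?_, ?_⟩
  · refine mem_of_forall_monomial_mem fun w hw => hv w j ?_
    rw [hcoeff] at hw
    exact (ite_ne_right_iff.mp hw).2
  · ext k w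
    rw [coeff_map_algebraMap_mulVec]
    simp only [hcoeff]
    by_cases hw : w ∈ s
    · simp only [hw, if_true]
      exact congrFun (hvu w) k
    · have hk : coeff w (u k) = 0 := by
        by_contra h
        exact hw (Finset.mem_biUnion.mpr ⟨k, Finset.mem_univ k, mem_support_iff.mpr h⟩)
      simp [hw, hk, Matrix.mulVec, dotProduct]

theorem exists_mulVec_eq_iff_mem_sum {R : ResData K σ} {I : Ideal (MvPolynomial σ K)}
    (hI : R.IsMinFreeResOf I) (Lvec : Fin (R.β 1) → Ideal (MvPolynomial τ K))
    (t : MvPolynomial τ K) :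
    (∃ u : Fin (R.β 1) → MvPolynomial τ K, (∀ j, u j ∈ Lvec j) ∧
      ∀ k, ((R.lam 0).map (algebraMap K (MvPolynomial τ K))).mulVec u k = t) ↔
        t ∈ ∑ j, Lvec j := by
  have huniq : ∀ k k' : Fin (R.β 0), k = k' := by
    rw [R.hβ0]
    exact fun k k' => Subsingleton.elim k k'
  let k₀ : Fin (R.β 0) := Fin.cast R.hβ0.symm 0
  constructor
  · rintro ⟨u, hu, hut⟩
    rw [← hut k₀]
    simp only [Matrix.mulVec, dotProduct]
    refine Ideal.sum_mem (∑ j, Lvec j) fun j _ => Ideal.mul_mem_left _ _ ?_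
    have hle : Lvec j ≤ ∑ j, Lvec j := by
      rw [Ideal.sum_eq_sup]
      exact Finset.le_sup (f := Lvec) (Finset.mem_univ j)
    exact hle (hu j)
  · intro ht
    rw [Ideal.sum_eq_sup, Finset.sup_eq_iSup, Submodule.mem_iSup_finset_iff_exists_sum] at ht
    obtain ⟨f, rfl⟩ := ht
    have hlam : ∀ j, R.lam 0 k₀ j ≠ 0 := by
      intro j
      obtain ⟨k, hk⟩ := hI.exists_lam_ne_zero 0 j
      rwa [huniq k₀ k]
    refine ⟨fun j => C (R.lam 0 k₀ j)⁻¹ * (f j : MvPolynomial τ K),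
      fun j => Ideal.mul_mem_left _ _ (f j).2, fun k => ?_⟩
    rw [huniq k k₀]
    simp only [Matrix.mulVec, dotProduct]
    refine Finset.sum_congr rfl fun j _ => ?_
    rw [Matrix.map_apply, algebraMap_eq, ← mul_assoc, ← C_mul, mul_inv_cancel₀ (hlam j), C_1,
      one_mul]

end Lstar

/-- **Theorem (main).** For `L_j = ∏_{l=1}^n L_{l, a_j(l)}`, the induced complex `F*`
of `L_1, …, L_m` is acyclic (`H_i(F*) = 0` for `i > 0`) with `H_0(F*) = T/L`,
`L = ∑_j L_j`: every cycle of `F*` in positive homological degree is a boundary, and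
the image of `∂* : F*_1 → F*_0 = T` is `L`. -/
theorem Fstar_acyclic_and_H0_eq_quotient
    {K : Type} [Field K] {n : ℕ} (mfam : Fin n → ℕ)
    (R : ResData K (Fin n)) (I : Ideal (MvPolynomial (Fin n) K))
    (hI : R.IsMinFreeResOf I) (hInotTop : I ≠ ⊤)
    (Lfam : Fin n → ℕ → Ideal (MvPolynomial ((i : Fin n) × Fin (mfam i)) K))
    (hmon : ∀ (l : Fin n) (j : Fin (R.β 1)),
      IsMonomialIdealOn {v : (i : Fin n) × Fin (mfam i) | v.1 = l} (Lfam l (R.a 1 j l)))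
    (hincl : ∀ (l : Fin n) (j k : Fin (R.β 1)),
      R.a 1 k l ≤ R.a 1 j l → Lfam l (R.a 1 j l) ≤ Lfam l (R.a 1 k l))
    (Lvec : Fin (R.β 1) → Ideal (MvPolynomial ((i : Fin n) × Fin (mfam i)) K))
    (hLvec : ∀ j, Lvec j = ∏ l, Lfam l (R.a 1 j l)) :
    -- acyclicity in positive homological degrees
    (∀ (i : ℕ) (u : Fin (R.β (i + 1)) → MvPolynomial ((i : Fin n) × Fin (mfam i)) K),
        (∀ j, u j ∈ Lstar R Lvec i j) →
        Matrix.mulVec ((R.lam i).map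
          (algebraMap K (MvPolynomial ((i : Fin n) × Fin (mfam i)) K))) u = 0 →
        ∃ v : Fin (R.β (i + 2)) → MvPolynomial ((i : Fin n) × Fin (mfam i)) K,
          (∀ j, v j ∈ Lstar R Lvec (i + 1) j) ∧
          Matrix.mulVec ((R.lam (i + 1)).map
            (algebraMap K (MvPolynomial ((i : Fin n) × Fin (mfam i)) K))) v = u) ∧
    -- `H_0(F*) = T/L` where `L = ∑_j L_j`
    (∀ t : MvPolynomial ((i : Fin n) × Fin (mfam i)) K,
        (∃ u : Fin (R.β 1) → MvPolynomial ((i : Fin n) × Fin (mfam i)) K,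
          (∀ j, u j ∈ Lvec j) ∧
          ∀ k, Matrix.mulVec ((R.lam 0).map
            (algebraMap K (MvPolynomial ((i : Fin n) × Fin (mfam i)) K))) u k = t) ↔
        t ∈ ∑ j, Lvec j) := by
  have hL : ∀ j, ∀ f ∈ Lvec j, ∀ w, coeff w f ≠ 0 → monomial w (1 : K) ∈ Lvec j := by
    intro j f hf w hw
    rw [hLvec] at hf ⊢
    exact monomial_mem_prod_of_mem_prod (fun l => hmon l j) hf hw
  refine ⟨exists_preimage_Lstar hI hL ?_, exists_mulVec_eq_iff_mem_sum hI Lvec⟩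
  classical
  have hmem : ∀ w j, monomial w (1 : K) ∈ Lvec j ↔
      ∀ l, monomial w (1 : K) ∈ Lfam l (R.a 1 j l) := by
    intro w j
    rw [hLvec, monomial_mem_prod_iff fun l => hmon l j]
  rintro w ⟨j₁, hj₁⟩
  rw [hmem] at hj₁
  let s : Fin n → Finset (Fin (R.β 1)) := fun l =>
    Finset.univ.filter fun j => monomial w (1 : K) ∈ Lfam l (R.a 1 j l)
  refine ⟨fun l => (s l).sup fun j => R.a 1 j l, fun j => (hmem w j).trans ⟨fun h l => ?_,
    fun h l => ?_⟩⟩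
  · exact Finset.le_sup (f := fun j => R.a 1 j l) (by simpa [s] using h l)
  · obtain ⟨k, hk, hsup⟩ := Finset.exists_mem_eq_sup (s l) ⟨j₁, by simpa [s] using hj₁ l⟩
      fun j => R.a 1 j l
    exact hincl l k j ((h l).trans hsup.le) (Finset.mem_filter.mp hk).2
end

section
/- Let G be the complete n-partite graph on the vertex set V = V_1 ∪ ⋯ ∪ V_n with V_i = {x_{i1},…,x_{im_i}}. Then the path ideal satisfies I_t(G) = Σ I_{1j_1} I_{2j_2} ⋯ I_{nj_n}, where the sum is over all tuples (j_1,…,j_n) with 0 ≤ j_i ≤ min{(t+1)/2, m_i} and Σ_{i=1}^n j_i = t, and where I_{ij_i} is the ideal generated by all squarefree monomials of degree j_i in the variables x_{i1},…,x_{im_i}. In particular, I_t(G) is the generalized mixed product ideal induced by the Veronese-type ideal generated by the monomials x_1^{j_1}⋯x_n^{j_n} with Σ j_i = t and 0 ≤ j_i ≤ min{(t+1)/2, m_i}. -/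
open MvPolynomial

/-- `P` is a path (of length `t`, i.e. with `t` vertices) in the complete
`n`-partite graph on the vertex set `V = V_1 ∪ ⋯ ∪ V_n`,
`V_i = {x_{i1}, …, x_{i m_i}}`: the vertices are pairwise distinct and two
consecutive vertices are adjacent, i.e. lie in different parts. -/
def IsPathCompleteMultipartite {n : ℕ} (mfam : Fin n → ℕ) {t : ℕ}
    (P : Fin t → ((i : Fin n) × Fin (mfam i))) : Prop :=
  Function.Injective P ∧
    ∀ (k : ℕ) (h : k + 1 < t), (P ⟨k, Nat.lt_of_succ_lt h⟩).1 ≠ (P ⟨k + 1, h⟩).1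

/-- The path ideal `I_t(G)` of the complete `n`-partite graph `G`, generated by the
monomials `x_{i_1} ⋯ x_{i_t}` corresponding to paths of length `t` in `G`. -/
noncomputable def pathIdealCompleteMultipartite (K : Type) [Field K] {n : ℕ}
    (mfam : Fin n → ℕ) (t : ℕ) :
    Ideal (MvPolynomial ((i : Fin n) × Fin (mfam i)) K) :=
  Ideal.span {f | ∃ P : Fin t → ((i : Fin n) × Fin (mfam i)),
    IsPathCompleteMultipartite mfam P ∧ f = ∏ k, X (P k)}

/-- The squarefree Veronese ideal `I_{i d}`, generated by all squarefree monomials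
of degree `d` in the variables `x_{i1}, …, x_{i m_i}`. -/
noncomputable def sqfreeVeronese (K : Type) [Field K] {n : ℕ} (mfam : Fin n → ℕ)
    (i : Fin n) (d : ℕ) : Ideal (MvPolynomial ((i : Fin n) × Fin (mfam i)) K) :=
  Ideal.span {f | ∃ s : Finset (Fin (mfam i)), s.card = d ∧
    f = ∏ v ∈ s, X (⟨i, v⟩ : (i : Fin n) × Fin (mfam i))}

/-- A finite coloured set `U` in which every colour is used at most `(#U + 1) / 2` times, and the
colour `p` at most `#U / 2` times, can be listed so that consecutive colours differ and the first
colour is not `p`. -/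
theorem exists_nodup_list_isChain_ne {α ι : Type*} [DecidableEq α] [DecidableEq ι] (f : α → ι)
    (U : Finset α) (p : ι) (hU : ∀ i, 2 * (U.filter (f · = i)).card ≤ U.card + 1)
    (hp : 2 * (U.filter (f · = p)).card ≤ U.card) :
    ∃ l : List α, l.Nodup ∧ l.toFinset = U ∧ (p :: l.map f).IsChain (· ≠ ·) := by
  induction h : U.card generalizing U p with
  | zero => exact ⟨[], by simp, by simpa using (Finset.card_eq_zero.1 h).symm, by simp⟩
  | succ n ih =>
    obtain ⟨a, ha, hap, hmax⟩ : ∃ a ∈ U, f a ≠ p ∧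
        ∀ i, i ≠ f a → 2 * (U.filter (f · = i)).card ≤ U.card := by
      by_cases hq : ∃ q, U.card < 2 * (U.filter (f · = q)).card
      · obtain ⟨q, hq⟩ := hq
        obtain ⟨a, ha⟩ : (U.filter (f · = q)).Nonempty := Finset.card_pos.1 (by omega)
        obtain ⟨haU, rfl⟩ := Finset.mem_filter.1 ha
        refine ⟨a, haU, fun h' => by rw [h'] at hq; omega, fun i hi => ?_⟩
        have hdisj : Disjoint (U.filter (f · = f a)) (U.filter (f · = i)) := by
          refine Finset.disjoint_filter.2 fun x _ h1 h2 => hi (h2.symm.trans h1)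
        have := Finset.card_le_card (Finset.union_subset (Finset.filter_subset (f · = f a) U)
          (Finset.filter_subset (f · = i) U))
        rw [Finset.card_union_of_disjoint hdisj] at this
        omega
      · push Not at hq
        obtain ⟨a, ha, hap⟩ : ∃ a ∈ U, f a ≠ p := by
          by_contra! hall
          rw [Finset.filter_true_of_mem hall] at hp
          omega
        exact ⟨a, ha, hap, fun i _ => hq i⟩
    have hcard : (U.erase a).card = n := by rw [Finset.card_erase_of_mem ha]; omega
    have hself : ((U.erase a).filter (f · = f a)).card + 1 = (U.filter (f · = f a)).card := by
      rw [Finset.filter_erase]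
      exact Finset.card_erase_add_one (Finset.mem_filter.2 ⟨ha, rfl⟩)
    have hsub : ∀ i, ((U.erase a).filter (f · = i)).card ≤ (U.filter (f · = i)).card := fun i =>
      Finset.card_le_card (Finset.filter_subset_filter _ (Finset.erase_subset _ _))
    have hfa := hU (f a)
    obtain ⟨l, hl, hlU, hc⟩ := ih (U.erase a) (f a) (fun i => by
      by_cases hi : i = f a
      · subst hi; omega
      · have := hmax i hi
        have := hsub i
        omega) (by omega) hcard
    refine ⟨a :: l, List.nodup_cons.2 ⟨?_, hl⟩, ?_, ?_⟩
    · rw [← List.mem_toFinset, hlU]; simp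
    · rw [List.toFinset_cons, hlU, Finset.insert_erase ha]
    · rw [List.map_cons, List.isChain_cons_cons]
      exact ⟨hap.symm, hc⟩

/-- A finite coloured set in which every colour is used at most `(#U + 1) / 2` times can be listed
so that consecutive colours differ. -/
theorem exists_nodup_list_isChain_map_ne {α ι : Type*} [DecidableEq α] [DecidableEq ι] (f : α → ι)
    (U : Finset α) (hU : ∀ i, 2 * (U.filter (f · = i)).card ≤ U.card + 1) :
    ∃ l : List α, l.Nodup ∧ l.toFinset = U ∧ l.IsChain (f · ≠ f ·) := by
  obtain ⟨l, hl, hlU, hc⟩ := exists_nodup_list_isChain_ne (fun a => some (f a)) U none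
    (fun i => by cases i <;> simp [hU]) (by simp)
  refine ⟨l, hl, hlU, ?_⟩
  simpa [List.isChain_map] using hc.of_cons

/-- A set of indices below `t` without two consecutive elements has at most `(t + 1) / 2`
elements. -/
theorem two_mul_card_le_of_no_consecutive {t : ℕ} (A : Finset (Fin t))
    (hA : ∀ k ∈ A, ∀ l ∈ A, (k : ℕ) + 1 ≠ l) : 2 * A.card ≤ t + 1 := by
  have hdisj : Disjoint (A.image fun k : Fin t => (k : ℕ) + 1) (A.image fun k : Fin t => (k : ℕ)) := by
    simp only [Finset.disjoint_left, Finset.mem_image]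
    rintro _ ⟨k, hk, rfl⟩ ⟨l, hl, h⟩
    exact hA k hk l hl h.symm
  have hsub : (A.image fun k : Fin t => (k : ℕ) + 1) ∪ (A.image fun k : Fin t => (k : ℕ)) ⊆
      Finset.range (t + 1) := by
    intro x
    simp only [Finset.mem_union, Finset.mem_image, Finset.mem_range]
    rintro (⟨k, -, rfl⟩ | ⟨k, -, rfl⟩) <;> omega
  have := Finset.card_le_card hsub
  rw [Finset.card_union_of_disjoint hdisj, Finset.card_range,
    Finset.card_image_of_injective _ (fun a b h => Fin.ext (Nat.succ_injective h)),
    Finset.card_image_of_injective _ Fin.val_injective] at this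
  omega

theorem sqfreeVeronese_antitone (K : Type) [Field K] {n : ℕ} (mfam : Fin n → ℕ) (i : Fin n) :
    Antitone (sqfreeVeronese K mfam i) := by
  intro d' d hd
  refine Ideal.span_le.2 ?_
  rintro _ ⟨s, rfl, rfl⟩
  obtain ⟨s', hs', hcard⟩ := Finset.exists_subset_card_eq hd
  rw [← Finset.prod_sdiff hs']
  exact Ideal.mul_mem_left _ _ (Ideal.subset_span ⟨s', hcard, rfl⟩)

theorem pathIdealCompleteMultipartite_le (K : Type) [Field K] {n : ℕ} (mfam : Fin n → ℕ) (t : ℕ) :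
    pathIdealCompleteMultipartite K mfam t ≤
      ⨆ (c : Fin n → ℕ) (_ : (∑ i, c i) = t ∧ ∀ i, 2 * c i ≤ t + 1 ∧ c i ≤ mfam i),
        ∏ i, sqfreeVeronese K mfam i (c i) := by
  refine Ideal.span_le.2 ?_
  rintro _ ⟨P, ⟨hinj, hadj⟩, rfl⟩
  let s : (i : Fin n) → Finset (Fin (mfam i)) := fun i =>
    Finset.univ.filter fun v => (⟨i, v⟩ : (i : Fin n) × Fin (mfam i)) ∈ Finset.univ.image P
  have hs : Finset.univ.sigma s = Finset.univ.image P := by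
    ext ⟨i, v⟩
    simp [s]
  have hsum : ∑ i, (s i).card = t := by
    rw [← Finset.card_sigma, hs, Finset.card_image_of_injective _ hinj, Finset.card_fin]
  have hcard : ∀ i, (s i).card = (Finset.univ.filter fun k => (P k).1 = i).card := by
    intro i
    rw [← Finset.card_image_of_injective (s i)
      (sigma_mk_injective (i := i) : (Sigma.mk i : _ → (i : Fin n) × Fin (mfam i)).Injective),
      ← Finset.card_image_of_injective (Finset.univ.filter fun k => (P k).1 = i) hinj]
    congr 1
    ext ⟨j, v⟩
    simp only [s, Finset.mem_image, Finset.mem_filter, Finset.mem_univ, true_and]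
    constructor
    · rintro ⟨w, ⟨k, hk⟩, hw⟩
      exact ⟨k, by rw [hk], hk.trans hw⟩
    · rintro ⟨k, rfl, hk⟩
      exact ⟨(P k).2, ⟨k, rfl⟩, hk⟩
  have hprod : ∏ k, (X (P k) : MvPolynomial ((i : Fin n) × Fin (mfam i)) K) =
      ∏ i, ∏ v ∈ s i, X ⟨i, v⟩ := by
    rw [← Finset.prod_sigma Finset.univ s (fun a => X a), hs, Finset.prod_image hinj.injOn]
  refine Ideal.mem_iSup_of_mem (fun i => (s i).card) (Ideal.mem_iSup_of_mem
    ⟨hsum, fun i => ⟨?_, by simpa using Finset.card_le_univ (s i)⟩⟩ ?_)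
  · rw [hprod]
    exact Ideal.prod_mem_prod fun i _ => Ideal.subset_span ⟨s i, rfl, rfl⟩
  · beta_reduce
    rw [hcard]
    refine two_mul_card_le_of_no_consecutive _ ?_
    rintro ⟨k, hk⟩ h1 ⟨l, hl⟩ h2 rfl
    rw [Finset.mem_filter] at h1 h2
    exact hadj k hl (h1.2.trans h2.2.symm)

theorem prod_sqfreeVeronese_le (K : Type) [Field K] {n : ℕ} (mfam : Fin n → ℕ) (t : ℕ)
    (c : Fin n → ℕ) (hsum : ∑ i, c i = t) (hc : ∀ i, 2 * c i ≤ t + 1) :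
    ∏ i, sqfreeVeronese K mfam i (c i) ≤ pathIdealCompleteMultipartite K mfam t := by
  unfold sqfreeVeronese
  rw [Ideal.prod_span, Ideal.span_le]
  intro f hf
  obtain ⟨g, hg, rfl⟩ := Set.mem_fintype_prod _ _ |>.1 hf
  choose s hs hgs using hg
  have hcard : (Finset.univ.sigma s).card = t := by
    rw [Finset.card_sigma, ← hsum]
    exact Finset.sum_congr rfl fun i _ => hs i
  have hfilter : ∀ i, ((Finset.univ.sigma s).filter (·.1 = i)).card = c i := by
    intro i
    rw [← hs i, ← Finset.card_image_of_injective (s i)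
      (sigma_mk_injective (i := i) : (Sigma.mk i : _ → (i : Fin n) × Fin (mfam i)).Injective)]
    congr 1
    ext ⟨j, v⟩
    simp only [Finset.mem_filter, Finset.mem_sigma, Finset.mem_univ, true_and, Finset.mem_image]
    constructor
    · rintro ⟨hv, rfl⟩
      exact ⟨v, hv, rfl⟩
    · rintro ⟨w, hw, h⟩
      cases h
      exact ⟨hw, rfl⟩
  obtain ⟨l, hl, hlU, hchain⟩ := exists_nodup_list_isChain_map_ne Sigma.fst (Finset.univ.sigma s)
    (fun i => by rw [hfilter, hcard]; exact hc i)
  obtain rfl : l.length = t := by rw [← hcard, ← hlU, List.toFinset_card_of_nodup hl]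
  refine Ideal.subset_span ⟨l.get, ⟨List.nodup_iff_injective_get.1 hl, fun k hk => ?_⟩, ?_⟩
  · exact List.isChain_iff_getElem.1 hchain k hk
  · rw [Finset.prod_congr rfl fun i _ => hgs i,
      ← Finset.prod_sigma Finset.univ s (fun a => X a), ← hlU, List.prod_toFinset _ hl]
    simp

/-- For the complete `n`-partite graph `G` on `V_1 ∪ ⋯ ∪ V_n`, the path ideal is
`I_t(G) = ∑ I_{1 j_1} I_{2 j_2} ⋯ I_{n j_n}`, the sum being over all
`(j_1, …, j_n)` with `∑ j_i = t` and `0 ≤ j_i ≤ min ((t+1)/2, m_i)` (that is,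
`2 j_i ≤ t + 1` and `j_i ≤ m_i`).  Moreover the squarefree Veronese ideals satisfy
`I_{i d} ⊆ I_{i d'}` for `d ≥ d'`, so that `I_t(G)` is the generalized mixed
product ideal induced by the ideal of Veronese type generated by the monomials
`x_1^{j_1} ⋯ x_n^{j_n}` with `∑ j_i = t` and `0 ≤ j_i ≤ min ((t+1)/2, m_i)`. -/
theorem pathIdeal_completeMultipartite_eq_sum_of_products
    (K : Type) [Field K] {n : ℕ} (mfam : Fin n → ℕ) (t : ℕ) :
    pathIdealCompleteMultipartite K mfam t =
      (⨆ (c : Fin n → ℕ) (_ : (∑ i, c i) = t ∧ ∀ i, 2 * c i ≤ t + 1 ∧ c i ≤ mfam i),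
        ∏ i, sqfreeVeronese K mfam i (c i)) ∧
    ∀ (i : Fin n) (d d' : ℕ), d' ≤ d →
      sqfreeVeronese K mfam i d ≤ sqfreeVeronese K mfam i d' := by
  refine ⟨le_antisymm (pathIdealCompleteMultipartite_le K mfam t) ?_,
    fun i _ _ h => sqfreeVeronese_antitone K mfam i h⟩
  exact iSup₂_le fun c hc => prod_sqfreeVeronese_le K mfam t c hc.1 fun i => (hc.2 i).1
end
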